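/- For every τ in the upper half-plane ℍ, S_{3,2}(τ) = 2 η(τ)² η(4τ)² / η(2τ); that is, ∑_{k∈ℤ} (6k+2) q^{(6k+2)²/12} = 2 q^{1/3} ∏_{n≥1} (1 − q^n)² (1 − q^{4n})² (1 − q^{2n})^{−1}. -/

import Mathlib

noncomputable section

open Complex

/-- `q = e^{2πiτ}`. -/
def qq (τ : ℂ) : ℂ := exp (2 * ↑Real.pi * I * τ)

/-- The Dedekind eta function `η(τ) = q^{1/24} ∏_{n≥1} (1 − qⁿ)`. -/
def dedekindEta (τ : ℂ) : ℂ := exp (2 * ↑Real.pi * I * τ / 24) * ∏' n : ℕ, (1 - qq τ ^ (n + 1))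

/-- The unary theta function `S_{m,r}(τ) = ∑_{k∈ℤ} (2mk+r) q^{(2mk+r)²/(4m)}`. -/
def Sth (m : ℕ) (r : ℤ) (τ : ℂ) : ℂ :=
  ∑' k : ℤ, ((2 * (m : ℤ) * k + r : ℤ) : ℂ) *
    exp (2 * ↑Real.pi * I * τ * (((2 * (m : ℤ) * k + r : ℤ) : ℂ) ^ 2 / (4 * (m : ℂ))))

open Filter Topology

/-- The finite Euler product `∏_{1 ≤ i ≤ n} (1 - qⁱ)`. -/
def eulerProd (q : ℂ) (n : ℕ) : ℂ := ∏ i ∈ Finset.range n, (1 - q ^ (i + 1))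

/-- The Euler function `∏_{n ≥ 1} (1 - qⁿ)`. -/
def eulerPhi (q : ℂ) : ℂ := ∏' n : ℕ, (1 - q ^ (n + 1))

/-- Gaussian binomial coefficients, defined by the `q`-Pascal rule. -/
def gaussBinom (q : ℂ) : ℕ → ℕ → ℂ
  | _, 0 => 1
  | 0, _ + 1 => 0
  | n + 1, k + 1 => gaussBinom q n k + q ^ (k + 1) * gaussBinom q n (k + 1)

lemma gaussBinom_zero_right (q : ℂ) (n : ℕ) : gaussBinom q n 0 = 1 := by
  cases n <;> rfl

lemma gaussBinom_succ_succ (q : ℂ) (n k : ℕ) :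
    gaussBinom q (n + 1) (k + 1) = gaussBinom q n k + q ^ (k + 1) * gaussBinom q n (k + 1) := rfl

lemma gaussBinom_eq_zero_of_lt (q : ℂ) {n k : ℕ} (h : n < k) : gaussBinom q n k = 0 := by
  induction n generalizing k with
  | zero => obtain ⟨k, rfl⟩ := Nat.exists_eq_succ_of_ne_zero h.ne'; rfl
  | succ n ih =>
    obtain ⟨k, rfl⟩ := Nat.exists_eq_succ_of_ne_zero (by omega : k ≠ 0)
    rw [Nat.succ_eq_add_one, gaussBinom_succ_succ, ih (by omega), ih (by omega)]
    simp

lemma eulerProd_succ (q : ℂ) (n : ℕ) :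
    eulerProd q (n + 1) = eulerProd q n * (1 - q ^ (n + 1)) := Finset.prod_range_succ _ _

lemma eulerProd_zero (q : ℂ) : eulerProd q 0 = 1 := Finset.prod_range_zero _

lemma gaussBinom_mul_eulerProd (q : ℂ) (m k : ℕ) :
    gaussBinom q (m + k) k * (eulerProd q k * eulerProd q m) = eulerProd q (m + k) := by
  induction hn : m + k generalizing m k with
  | zero =>
    obtain ⟨rfl, rfl⟩ : m = 0 ∧ k = 0 := by omega
    simp [gaussBinom_zero_right, eulerProd_zero]
  | succ n ih =>
    rcases k with _ | k
    · obtain rfl : m = n + 1 := by omega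
      simp [gaussBinom_zero_right, eulerProd_zero]
    rcases m with _ | m
    · obtain rfl : k = n := by omega
      have h := ih 0 k (by omega)
      rw [eulerProd_zero, mul_one] at h
      rw [gaussBinom_succ_succ, gaussBinom_eq_zero_of_lt q (Nat.lt_succ_self k), eulerProd_zero,
        eulerProd_succ]
      linear_combination (1 - q ^ (k + 1)) * h
    · have h₁ := ih (m + 1) k (by omega)
      have h₂ := ih m (k + 1) (by omega)
      obtain rfl : n = m + k + 1 := by omega
      rw [gaussBinom_succ_succ, eulerProd_succ q k, eulerProd_succ q m,
        eulerProd_succ q (m + k + 1)]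
      rw [eulerProd_succ q m] at h₁
      rw [eulerProd_succ q k] at h₂
      linear_combination (1 - q ^ (k + 1)) * h₁ + q ^ (k + 1) * (1 - q ^ (m + 1)) * h₂

/-- The `q`-binomial theorem, in base `q²`. -/
lemma prod_one_sub_mul_pow_eq_sum {q : ℂ} (hq : q ≠ 0) (n : ℕ) (x : ℂ) :
    ∏ i ∈ Finset.range n, (1 - x * q ^ (2 * i)) =
      ∑ k ∈ Finset.range (n + 1),
        gaussBinom (q ^ 2) n k * ((-x) ^ k * q ^ ((k : ℤ) * (k - 1))) := by
  induction n generalizing x with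
  | zero => simp [gaussBinom_zero_right]
  | succ n ih =>
    have hx : ∏ i ∈ Finset.range n, (1 - x * q ^ (2 * (i + 1))) =
        ∏ i ∈ Finset.range n, (1 - x * q ^ 2 * q ^ (2 * i)) :=
      Finset.prod_congr rfl fun i _ ↦ by ring
    set S : ℕ → ℂ := fun k ↦ gaussBinom (q ^ 2) n k *
      ((-(x * q ^ 2)) ^ k * q ^ ((k : ℤ) * (k - 1))) with hS
    have key (k : ℕ) : gaussBinom (q ^ 2) (n + 1) (k + 1) *
        ((-x) ^ (k + 1) * q ^ (((k + 1 : ℕ) : ℤ) * ((k + 1 : ℕ) - 1))) = S (k + 1) - x * S k := by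
      have e₁ : q ^ (((k + 1 : ℕ) : ℤ) * ((k + 1 : ℕ) - 1)) =
          q ^ ((k : ℤ) * (k - 1)) * q ^ (2 * k) := by
        rw [← zpow_natCast, ← zpow_add₀ hq]; congr 1; push_cast; ring
      simp only [hS, gaussBinom_succ_succ, e₁]
      ring
    have hlast : S (n + 1) = 0 := by simp [hS, gaussBinom_eq_zero_of_lt]
    rw [Finset.prod_range_succ', hx, ih, Finset.sum_range_succ' _ (n + 1), Finset.sum_congr rfl
      fun k _ ↦ key k, Finset.sum_sub_distrib, ← Finset.mul_sum]
    have := Finset.sum_range_succ' S (n + 1)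
    rw [Finset.sum_range_succ S (n + 1), hlast] at this
    have h0 : S 0 = 1 := by simp [hS, gaussBinom_zero_right]
    rw [h0] at this
    simp only [gaussBinom_zero_right]
    push_cast
    simp only [pow_zero, zpow_zero, mul_one]
    linear_combination this

/-- The finite form of the Jacobi triple product identity, in base `q²`. -/
lemma prod_mul_prod_eq_sum {q z : ℂ} (hq : q ≠ 0) (hz : z ≠ 0) (N : ℕ) :
    (∏ i ∈ Finset.range N, (1 - z * q ^ (2 * i))) *
      ∏ i ∈ Finset.range N, (1 - z⁻¹ * q ^ (2 * i + 2)) =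
      ∑ k ∈ Finset.range (2 * N + 1), gaussBinom (q ^ 2) (2 * N) k *
        ((-z) ^ ((k : ℤ) - N) * q ^ (((k : ℤ) - N) * ((k : ℤ) - N - 1))) := by
  have hnz : -z ≠ 0 := neg_ne_zero.2 hz
  have h := prod_one_sub_mul_pow_eq_sum hq (2 * N) (z * q ^ (-2 * N : ℤ))
  have hrefl : ∏ i ∈ Finset.range N, (1 - z * q ^ (-2 * N : ℤ) * q ^ (2 * i)) =
      (-z) ^ N * q ^ (-(N : ℤ) * (N + 1)) *
        ∏ i ∈ Finset.range N, (1 - z⁻¹ * q ^ (2 * i + 2)) := by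
    rw [← Finset.prod_range_reflect]
    clear h
    have hterm : ∀ i ∈ Finset.range N, 1 - z * q ^ (-2 * N : ℤ) * q ^ (2 * (N - 1 - i)) =
        (-z) * q ^ (-2 * (i + 1) : ℤ) * (1 - z⁻¹ * q ^ (2 * i + 2)) := by
      intro i hi
      have hi := Finset.mem_range.1 hi
      have e₁ : q ^ (-2 * N : ℤ) * q ^ (2 * (N - 1 - i)) = q ^ (-2 * (i + 1) : ℤ) := by
        rw [← zpow_natCast, ← zpow_add₀ hq]; congr 1; omega
      have e₂ : q ^ (-2 * (i + 1) : ℤ) * q ^ (2 * i + 2) = 1 := by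
        rw [← zpow_natCast, ← zpow_add₀ hq, ← zpow_zero q]; congr 1; push_cast; ring
      have e₃ : z * z⁻¹ = 1 := mul_inv_cancel₀ hz
      linear_combination (-z) * e₁ - e₂ - (q ^ (-2 * (i + 1) : ℤ) * q ^ (2 * i + 2)) * e₃
    rw [Finset.prod_congr rfl hterm, Finset.prod_mul_distrib, Finset.prod_mul_distrib,
      Finset.prod_const, Finset.card_range]
    congr 2
    clear hterm
    induction N with
    | zero => simp
    | succ N ih =>
      rw [Finset.prod_range_succ, ih, ← zpow_add₀ hq]; congr 1; push_cast; ring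
  have hright : ∏ i ∈ Finset.range N, (1 - z * q ^ (-2 * N : ℤ) * q ^ (2 * (N + i))) =
      ∏ i ∈ Finset.range N, (1 - z * q ^ (2 * i)) := by
    refine Finset.prod_congr rfl fun i _ ↦ ?_
    rw [mul_assoc, ← zpow_natCast q (2 * (N + i)), ← zpow_add₀ hq, ← zpow_natCast]
    congr 3; push_cast; ring
  rw [two_mul N, Finset.prod_range_add, ← two_mul, hrefl, hright] at h
  have hc : (-z) ^ N * q ^ (-(N : ℤ) * (N + 1)) ≠ 0 :=
    mul_ne_zero (pow_ne_zero _ hnz) (zpow_ne_zero _ hq)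
  refine mul_left_cancel₀ hc ?_
  rw [Finset.mul_sum]
  calc _ = _ := by ring
    _ = _ := h
    _ = _ := Finset.sum_congr rfl fun k _ ↦ ?_
  have e₁ : (-z) ^ k = (-z) ^ N * (-z) ^ ((k : ℤ) - N) := by
    rw [← zpow_natCast, ← zpow_natCast, ← zpow_add₀ hnz]; congr 1; ring
  have e₂ : (q ^ (-2 * N : ℤ)) ^ k * q ^ ((k : ℤ) * (k - 1)) =
      q ^ (-(N : ℤ) * (N + 1)) * q ^ (((k : ℤ) - N) * ((k : ℤ) - N - 1)) := by
    rw [← zpow_natCast, ← zpow_mul, ← zpow_add₀ hq, ← zpow_add₀ hq]; congr 1; ring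
  rw [← neg_mul, mul_pow, e₁]
  linear_combination (gaussBinom (q ^ 2) (2 * N) k * (-z) ^ N * (-z) ^ ((k : ℤ) - N)) * e₂

lemma one_sub_pow_succ_ne_zero {q : ℂ} (hq : ‖q‖ < 1) (n : ℕ) : 1 - q ^ (n + 1) ≠ 0 := by
  intro h
  have h1 : ‖q ^ (n + 1)‖ = 1 := by rw [← sub_eq_zero.1 h, norm_one]
  rw [norm_pow] at h1
  exact (pow_lt_one₀ (norm_nonneg q) hq n.succ_ne_zero).ne h1

lemma eulerProd_ne_zero {q : ℂ} (hq : ‖q‖ < 1) (n : ℕ) : eulerProd q n ≠ 0 :=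
  Finset.prod_ne_zero_iff.2 fun i _ ↦ one_sub_pow_succ_ne_zero hq i

lemma eulerPhi_ne_zero {q : ℂ} (hq : ‖q‖ < 1) : eulerPhi q ≠ 0 := by
  have := tprod_one_add_ne_zero_of_summable (f := fun n : ℕ ↦ -q ^ (n + 1))
    (fun n ↦ by simpa [← sub_eq_add_neg] using one_sub_pow_succ_ne_zero hq n)
    (by simpa using (summable_nat_add_iff (f := fun n ↦ ‖q‖ ^ n) 1).2 (summable_geometric_of_lt_one (norm_nonneg q) hq))
  simpa [eulerPhi, sub_eq_add_neg] using this

lemma tendsto_eulerProd {q : ℂ} (hq : ‖q‖ < 1) :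
    Tendsto (eulerProd q) atTop (𝓝 (eulerPhi q)) :=
  (ModularForm.multipliable_one_sub_pow hq).tendsto_prod_tprod_nat

lemma gaussBinom_eq_div {q : ℂ} (hq : ‖q‖ < 1) {n k : ℕ} (h : k ≤ n) :
    gaussBinom q n k = eulerProd q n / (eulerProd q k * eulerProd q (n - k)) := by
  have := gaussBinom_mul_eulerProd q (n - k) k
  rw [Nat.sub_add_cancel h] at this
  rw [eq_div_iff (mul_ne_zero (eulerProd_ne_zero hq _) (eulerProd_ne_zero hq _)), this]

lemma exists_norm_gaussBinom_le {q : ℂ} (hq : ‖q‖ < 1) : ∃ C, ∀ n k, ‖gaussBinom q n k‖ ≤ C := by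
  have h₁ := tendsto_eulerProd hq
  obtain ⟨A, hA⟩ := h₁.norm.bddAbove_range
  obtain ⟨B, hB⟩ := (h₁.inv₀ (eulerPhi_ne_zero hq)).norm.bddAbove_range
  have hA' (n) : ‖eulerProd q n‖ ≤ A := hA ⟨n, rfl⟩
  have hB' (n) : ‖(eulerProd q n)⁻¹‖ ≤ B := hB ⟨n, rfl⟩
  have hA0 : 0 ≤ A := (norm_nonneg _).trans (hA' 0)
  have hB0 : 0 ≤ B := (norm_nonneg _).trans (hB' 0)
  refine ⟨A * (B * B), fun n k ↦ ?_⟩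
  rcases le_or_gt k n with h | h
  · rw [gaussBinom_eq_div hq h, div_eq_mul_inv, mul_inv, norm_mul, norm_mul]
    gcongr
    exacts [hA' _, hB' _, hB' _]
  · rw [gaussBinom_eq_zero_of_lt q h, norm_zero]; positivity

/-- Weighting a summable family by central Gaussian binomial coefficients and letting
their size grow multiplies its sum by `1 / φ(q)`. -/
lemma tendsto_sum_gaussBinom_mul {q : ℂ} (hq : ‖q‖ < 1) {a : ℤ → ℂ} (ha : Summable a) :
    Tendsto (fun N : ℕ ↦ ∑ k ∈ Finset.range (2 * N + 1),
      gaussBinom q (2 * N) k * a ((k : ℤ) - N)) atTop (𝓝 ((∑' k, a k) / eulerPhi q)) := by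
  obtain ⟨C, hC⟩ := exists_norm_gaussBinom_le hq
  set f : ℕ → ℤ → ℂ := fun N l ↦
    if 0 ≤ l + N then gaussBinom q (2 * N) (l + N).toNat * a l else 0 with hf
  have hsum (N : ℕ) : ∑ k ∈ Finset.range (2 * N + 1), gaussBinom q (2 * N) k * a ((k : ℤ) - N) =
      ∑' l, f N l := by
    have hinj : Function.Injective fun k : ℕ ↦ (k : ℤ) - N := fun a b h ↦ by
      simpa using h
    rw [← hinj.tsum_eq (f := f N), tsum_eq_sum (s := Finset.range (2 * N + 1))]
    · simp [hf]
    · intro k hk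
      simp only [Finset.mem_range, not_lt] at hk
      simp [hf, gaussBinom_eq_zero_of_lt q (by omega : 2 * N < k)]
    · intro l hl
      by_cases h : 0 ≤ l + N
      · exact ⟨(l + N).toNat, by simp [h]⟩
      · simp [hf, h] at hl
  simp_rw [hsum]
  rw [← tsum_div_const]
  refine tendsto_tsum_of_dominated_convergence (bound := fun l ↦ C * ‖a l‖)
    (ha.norm.mul_left C) (fun l ↦ ?_) (.of_forall fun N l ↦ ?_)
  · have hφ := eulerPhi_ne_zero hq
    have t₀ := tendsto_eulerProd hq
    have t₁ : Tendsto (fun N : ℕ ↦ eulerProd q (2 * N)) atTop (𝓝 (eulerPhi q)) :=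
      t₀.comp (tendsto_atTop_mono (fun N ↦ Nat.le_mul_of_pos_left N two_pos) tendsto_id)
    have t₂ : Tendsto (fun N : ℕ ↦ eulerProd q (l + N).toNat) atTop (𝓝 (eulerPhi q)) :=
      t₀.comp (tendsto_atTop.2 fun b ↦
        (eventually_ge_atTop (b + l.natAbs)).mono fun N hN ↦ by omega)
    have t₃ : Tendsto (fun N : ℕ ↦ eulerProd q (2 * N - (l + N).toNat)) atTop
        (𝓝 (eulerPhi q)) :=
      t₀.comp (tendsto_atTop.2 fun b ↦
        (eventually_ge_atTop (b + l.natAbs)).mono fun N hN ↦ by omega)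
    have t := (t₁.div (t₂.mul t₃) (mul_ne_zero hφ hφ)).mul_const (a l)
    have hlim : eulerPhi q / (eulerPhi q * eulerPhi q) * a l = a l / eulerPhi q := by
      field_simp
    rw [hlim] at t
    refine t.congr' ((eventually_ge_atTop l.natAbs).mono fun N hN ↦ ?_)
    simp only [hf]
    rw [if_pos (by omega), gaussBinom_eq_div hq (by omega)]
    rfl
  · simp only [hf]
    split_ifs
    · rw [norm_mul]; gcongr; exact hC _ _
    · rw [norm_zero]; exact mul_nonneg ((norm_nonneg _).trans (hC 0 0)) (norm_nonneg _)

lemma summable_norm_pow_mul_zpow {q : ℂ} (hq0 : q ≠ 0) (hq : ‖q‖ < 1) (d : ℕ) {a : ℤ}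
    (ha : 0 < a) (b : ℤ) :
    Summable fun k : ℤ ↦ ‖(k : ℂ) ^ d * q ^ (a * k ^ 2 + b * k)‖ := by
  have hpos : 0 < ‖q‖ := norm_pos_iff.2 hq0
  have hL : 0 < -Real.log ‖q‖ := neg_pos.2 (Real.log_neg hpos hq)
  have haR : (0 : ℝ) < a := by exact_mod_cast ha
  set L := -Real.log ‖q‖ with hLdef
  refine (summable_pow_mul_jacobiTheta₂_term_bound (|(b : ℝ)| * L / (2 * Real.pi))
    (T := a * L / Real.pi) (div_pos (mul_pos haR hL) Real.pi_pos) d).of_nonneg_of_le (fun _ ↦ norm_nonneg _) fun k ↦ ?_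
  rw [norm_mul, norm_pow, norm_zpow, Complex.norm_intCast, ← Int.cast_abs, ← Real.rpow_intCast,
    Real.rpow_def_of_pos hpos]
  refine mul_le_mul_of_nonneg_left (Real.exp_le_exp.2 ?_) (by positivity)
  have h : -Real.pi * (a * L / Real.pi * k ^ 2 -
      2 * (|(b : ℝ)| * L / (2 * Real.pi)) * ((|k| : ℤ) : ℝ)) =
      -L * (a * k ^ 2 - |(b : ℝ) * k|) := by
    rw [abs_mul]; push_cast; field_simp
  push_cast at h ⊢
  rw [h, show Real.log ‖q‖ = -L by rw [hLdef, neg_neg]]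
  have := neg_abs_le ((b : ℝ) * k)
  exact mul_le_mul_of_nonpos_left (by linarith) (by linarith)

lemma norm_neg_one_zpow_mul (k : ℤ) (z : ℂ) : ‖(-1) ^ k * z‖ = ‖z‖ := by
  rw [norm_mul, norm_zpow, norm_neg, norm_one, one_zpow, one_mul]

/-- The Jacobi triple product identity in base `q²`, as a limit of finite products. -/
lemma tendsto_prod_mul_prod {q z : ℂ} (hq0 : q ≠ 0) (hq : ‖q‖ < 1) (hz : z ≠ 0)
    (hs : Summable fun k : ℤ ↦ (-z) ^ k * q ^ (k * (k - 1))) :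
    Tendsto (fun N : ℕ ↦ (∏ i ∈ Finset.range N, (1 - z * q ^ (2 * i))) *
      ∏ i ∈ Finset.range N, (1 - z⁻¹ * q ^ (2 * i + 2))) atTop
      (𝓝 ((∑' k : ℤ, (-z) ^ k * q ^ (k * (k - 1))) / eulerPhi (q ^ 2))) := by
  have hq2 : ‖q ^ 2‖ < 1 := by rw [norm_pow]; exact pow_lt_one₀ (norm_nonneg _) hq two_ne_zero
  exact (tendsto_sum_gaussBinom_mul hq2 hs).congr fun N ↦ (prod_mul_prod_eq_sum hq0 hz N).symm

/-- Gauss's identity for `∑ (-1)ᵏ q^(k²)`. -/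
lemma tsum_neg_one_zpow_mul_zpow_sq {q : ℂ} (hq0 : q ≠ 0) (hq : ‖q‖ < 1) :
    ∑' k : ℤ, (-1) ^ k * q ^ (k ^ 2) = eulerPhi q ^ 2 / eulerPhi (q ^ 2) := by
  have hq2 : ‖q ^ 2‖ < 1 := by rw [norm_pow]; exact pow_lt_one₀ (norm_nonneg _) hq two_ne_zero
  have hφ := eulerPhi_ne_zero hq2
  have hfin (N : ℕ) : eulerProd q (2 * N) =
      (∏ i ∈ Finset.range N, (1 - q ^ (2 * i + 1))) * eulerProd (q ^ 2) N := by
    induction N with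
    | zero => simp [eulerProd_zero]
    | succ N ih =>
      rw [mul_add, mul_one, eulerProd_succ, eulerProd_succ, ih, Finset.prod_range_succ,
        eulerProd_succ]
      ring
  have hterm (k : ℤ) : (-q) ^ k * q ^ (k * (k - 1)) = (-1) ^ k * q ^ (k ^ 2) := by
    rw [neg_eq_neg_one_mul q, mul_zpow, mul_assoc, ← zpow_add₀ hq0]; congr 2; ring
  have hs : Summable fun k : ℤ ↦ (-q) ^ k * q ^ (k * (k - 1)) := by
    refine Summable.of_norm ?_
    simpa [hterm, norm_neg_one_zpow_mul] using
      summable_norm_pow_mul_zpow hq0 hq 0 (a := 1) one_pos 0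
  have h₁ := tendsto_prod_mul_prod hq0 hq hq0 hs
  have h₂ : Tendsto (fun N : ℕ ↦ (eulerProd q (2 * N) / eulerProd (q ^ 2) N) ^ 2) atTop
      (𝓝 ((eulerPhi q / eulerPhi (q ^ 2)) ^ 2)) :=
    (((tendsto_eulerProd hq).comp (tendsto_id.const_mul_atTop' two_pos)).div
      (tendsto_eulerProd hq2) hφ).pow 2
  have h := tendsto_nhds_unique (h₁.congr fun N ↦ ?_) h₂
  · simp only [hterm] at h
    field_simp at h ⊢
    exact h
  · rw [hfin, mul_div_cancel_right₀ _ (eulerProd_ne_zero hq2 N), sq]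
    congr 1 <;> refine Finset.prod_congr rfl fun i _ ↦ ?_
    · ring
    · rw [pow_succ q (2 * i + 1)]; field_simp

/-- Euler's pentagonal number theorem, in base `q²`. -/
lemma tsum_neg_one_zpow_mul_zpow_pentagonal {q : ℂ} (hq0 : q ≠ 0) (hq : ‖q‖ < 1) :
    ∑' k : ℤ, (-1) ^ k * q ^ (3 * k ^ 2 + k) = eulerPhi (q ^ 2) := by
  have hq2 : ‖q ^ 2‖ < 1 := by rw [norm_pow]; exact pow_lt_one₀ (norm_nonneg _) hq two_ne_zero
  have hq3 : ‖q ^ 3‖ < 1 := by rw [norm_pow]; exact pow_lt_one₀ (norm_nonneg _) hq three_ne_zero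
  have hq6 : ‖(q ^ 3) ^ 2‖ < 1 := by
    rw [norm_pow]; exact pow_lt_one₀ (norm_nonneg _) hq3 two_ne_zero
  have hφ := eulerPhi_ne_zero hq6
  have hfin (N : ℕ) : eulerProd (q ^ 2) (3 * N) =
      (∏ i ∈ Finset.range N, (1 - q ^ (6 * i + 2)) * (1 - q ^ (6 * i + 4))) *
        eulerProd ((q ^ 3) ^ 2) N := by
    induction N with
    | zero => simp [eulerProd_zero]
    | succ N ih =>
      rw [mul_add, mul_one, eulerProd_succ, eulerProd_succ, eulerProd_succ, ih,
        Finset.prod_range_succ, eulerProd_succ]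
      ring
  have hterm (k : ℤ) : (-q ^ 2) ^ k * (q ^ 3) ^ (k * (k - 1)) =
      (-1) ^ k * q ^ (3 * k ^ 2 + -1 * k) := by
    rw [neg_eq_neg_one_mul (q ^ 2), mul_zpow, mul_assoc, ← zpow_natCast q 2, ← zpow_natCast q 3,
      ← zpow_mul, ← zpow_mul, ← zpow_add₀ hq0]
    congr 2; push_cast; ring
  have hs : Summable fun k : ℤ ↦ (-q ^ 2) ^ k * (q ^ 3) ^ (k * (k - 1)) := by
    refine Summable.of_norm ?_
    simpa only [hterm, norm_neg_one_zpow_mul, pow_zero, one_mul] using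
      summable_norm_pow_mul_zpow hq0 hq 0 (a := 3) three_pos (-1)
  have h₁ := tendsto_prod_mul_prod (pow_ne_zero 3 hq0) hq3 (pow_ne_zero 2 hq0) hs
  have h₂ : Tendsto (fun N : ℕ ↦ eulerProd (q ^ 2) (3 * N) / eulerProd ((q ^ 3) ^ 2) N) atTop
      (𝓝 (eulerPhi (q ^ 2) / eulerPhi ((q ^ 3) ^ 2))) :=
    ((tendsto_eulerProd hq2).comp (tendsto_id.const_mul_atTop' three_pos)).div
      (tendsto_eulerProd hq6) hφ
  have h := tendsto_nhds_unique (h₁.congr fun N ↦ ?_) h₂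
  · rw [div_left_inj' hφ] at h
    rw [← h, ← (Equiv.neg ℤ).tsum_eq]
    refine tsum_congr fun k ↦ ?_
    rw [hterm, Equiv.neg_apply, zpow_neg, ← inv_zpow, inv_neg, inv_one]
    congr 2; ring
  · rw [hfin, mul_div_cancel_right₀ _ (eulerProd_ne_zero hq6 N), Finset.prod_mul_distrib]
    congr 1 <;> refine Finset.prod_congr rfl fun i _ ↦ ?_
    · ring
    · field_simp; ring

lemma tsum_neg_one_zpow_mul_mul_zpow {q : ℂ} (hq0 : q ≠ 0) (hq : ‖q‖ < 1) :
    ∑' k : ℤ, (-1) ^ k * (k * q ^ (k ^ 2 - k)) = -eulerPhi (q ^ 2) ^ 3 := by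
  have hq2 : ‖q ^ 2‖ < 1 := by rw [norm_pow]; exact pow_lt_one₀ (norm_nonneg _) hq two_ne_zero
  have hφ := eulerPhi_ne_zero hq2
  have hs : Summable fun k : ℤ ↦ (-1 : ℂ) ^ k * (k * q ^ (k ^ 2 - k)) := by
    refine Summable.of_norm ?_
    simpa only [norm_neg_one_zpow_mul, pow_one, one_mul, neg_mul, ← sub_eq_add_neg] using
      summable_norm_pow_mul_zpow hq0 hq 1 (a := 1) one_pos (-1)
  have hfin (N : ℕ) : ∑ k ∈ Finset.range (2 * (N + 1) + 1), gaussBinom (q ^ 2) (2 * (N + 1)) k *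
      ((-1) ^ ((k : ℤ) - (N + 1 : ℕ)) * (((k : ℤ) - (N + 1 : ℕ) : ℤ) *
        q ^ (((k : ℤ) - (N + 1 : ℕ)) ^ 2 - ((k : ℤ) - (N + 1 : ℕ))))) =
      -(eulerProd (q ^ 2) N * eulerProd (q ^ 2) (N + 1)) := by
    set R : ℂ → ℂ := fun z ↦ (∏ i ∈ Finset.range N, (1 - z * q ^ (2 * (i + 1)))) *
      ∏ i ∈ Finset.range (N + 1), (1 - z⁻¹ * q ^ (2 * i + 2)) with hR
    have hRd : DifferentiableAt ℂ R 1 := by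
      refine DifferentiableAt.mul ?_ ?_
      · exact DifferentiableAt.fun_finsetProd fun i _ ↦ by fun_prop
      · exact DifferentiableAt.fun_finsetProd fun i _ ↦ by fun_prop (disch := exact one_ne_zero)
    have hR1 : R 1 = eulerProd (q ^ 2) N * eulerProd (q ^ 2) (N + 1) := by
      simp [hR, eulerProd, ← pow_mul, mul_add]
    have hleft : HasDerivAt (fun z ↦ (1 - z) * R z) (-R 1) 1 := by
      have := ((hasDerivAt_id (1 : ℂ)).const_sub 1).fun_mul hRd.hasDerivAt
      simpa using this
    have hright : HasDerivAt (fun z : ℂ ↦ ∑ k ∈ Finset.range (2 * (N + 1) + 1),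
        gaussBinom (q ^ 2) (2 * (N + 1)) k * ((-1) ^ ((k : ℤ) - (N + 1 : ℕ)) *
          (z ^ ((k : ℤ) - (N + 1 : ℕ)) *
            q ^ (((k : ℤ) - (N + 1 : ℕ)) ^ 2 - ((k : ℤ) - (N + 1 : ℕ))))))
        (∑ k ∈ Finset.range (2 * (N + 1) + 1), gaussBinom (q ^ 2) (2 * (N + 1)) k *
      ((-1) ^ ((k : ℤ) - (N + 1 : ℕ)) * (((k : ℤ) - (N + 1 : ℕ) : ℤ) *
        q ^ (((k : ℤ) - (N + 1 : ℕ)) ^ 2 - ((k : ℤ) - (N + 1 : ℕ)))))) 1 := by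
      refine HasDerivAt.fun_sum fun k _ ↦ ?_
      refine HasDerivAt.const_mul _ (HasDerivAt.const_mul _ (HasDerivAt.mul_const ?_ _))
      simpa using hasDerivAt_zpow ((k : ℤ) - (N + 1 : ℕ)) (1 : ℂ) (Or.inl one_ne_zero)
    rw [← hR1]
    refine hright.unique (hleft.congr_of_eventuallyEq ?_)
    filter_upwards [isOpen_ne.mem_nhds (one_ne_zero (α := ℂ))] with z hz
    have h := prod_mul_prod_eq_sum hq0 hz (N + 1)
    rw [Finset.prod_range_succ'] at h
    simp only [hR]
    calc _ = _ := Finset.sum_congr rfl fun k _ ↦ ?_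
      _ = _ := h.symm
      _ = _ := by ring
    rw [neg_eq_neg_one_mul z, mul_zpow, mul_assoc]
    congr 4
    ring
  have h₁ := ((tendsto_sum_gaussBinom_mul hq2 hs).comp (tendsto_add_atTop_nat 1)).congr hfin
  have h₂ := ((tendsto_eulerProd hq2).mul
    ((tendsto_eulerProd hq2).comp (tendsto_add_atTop_nat 1))).neg
  have h := tendsto_nhds_unique h₁ h₂
  rw [div_eq_iff hφ] at h
  rw [h]; ring

/-- Jacobi's identity for the cube of the Euler function, in base `q²`. -/
lemma tsum_neg_one_zpow_mul_zpow_triangular {q : ℂ} (hq0 : q ≠ 0) (hq : ‖q‖ < 1) :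
    ∑' k : ℤ, (-1) ^ k * ((2 * k + 1) * q ^ (k ^ 2 + k)) = 2 * eulerPhi (q ^ 2) ^ 3 := by
  have hs : Summable fun k : ℤ ↦ (-1 : ℂ) ^ k * (k * q ^ (k ^ 2 + k)) := by
    refine Summable.of_norm ?_
    simpa only [norm_neg_one_zpow_mul, pow_one, one_mul] using
      summable_norm_pow_mul_zpow hq0 hq 1 (a := 1) one_pos 1
  have h := tsum_neg_one_zpow_mul_mul_zpow hq0 hq
  have h₁ : ∑' k : ℤ, (-1 : ℂ) ^ k * (k * q ^ (k ^ 2 + k)) = eulerPhi (q ^ 2) ^ 3 := by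
    rw [← (Equiv.neg ℤ).tsum_eq, ← neg_eq_iff_eq_neg.2 h, ← tsum_neg]
    refine tsum_congr fun k ↦ ?_
    simp only [Equiv.neg_apply, zpow_neg, ← inv_zpow, inv_neg, inv_one, Int.cast_neg, neg_sq,
      ← sub_eq_add_neg]
    ring
  have h₂ : ∑' k : ℤ, (-1 : ℂ) ^ k * ((k + 1) * q ^ (k ^ 2 + k)) = eulerPhi (q ^ 2) ^ 3 := by
    rw [← (Equiv.subRight (1 : ℤ)).tsum_eq, ← neg_eq_iff_eq_neg.2 h, ← tsum_neg]
    refine tsum_congr fun k ↦ ?_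
    simp only [Equiv.subRight_apply, zpow_sub_one₀ (neg_ne_zero.2 (one_ne_zero (α := ℂ))),
      inv_neg, inv_one, Int.cast_sub, Int.cast_one, sub_add_cancel]
    rw [show (k - 1) ^ 2 + (k - 1) = k ^ 2 - k by ring]
    ring
  have hs' : Summable fun k : ℤ ↦ (-1 : ℂ) ^ k * ((k + 1) * q ^ (k ^ 2 + k)) := by
    have h0 : Summable fun k : ℤ ↦ (-1 : ℂ) ^ k * q ^ (k ^ 2 + k) := by
      refine Summable.of_norm ?_
      simpa only [norm_neg_one_zpow_mul, pow_zero, one_mul] using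
        summable_norm_pow_mul_zpow hq0 hq 0 (a := 1) one_pos 1
    exact (hs.add h0).congr fun k ↦ by ring
  calc _ = ∑' k : ℤ, ((-1 : ℂ) ^ k * (k * q ^ (k ^ 2 + k)) +
        (-1 : ℂ) ^ k * ((k + 1) * q ^ (k ^ 2 + k))) := tsum_congr fun k ↦ by ring
    _ = _ := by rw [hs.tsum_add hs', h₁, h₂, two_mul]

lemma neg_one_zpow_two_mul_add (k j : ℤ) : (-1 : ℂ) ^ (2 * k + j) = (-1) ^ j := by
  rw [zpow_add₀ (by norm_num), (even_two_mul k).neg_one_zpow, one_mul]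

lemma neg_one_zpow_two_mul_sub (k j : ℤ) : (-1 : ℂ) ^ (2 * k - j) = (-1) ^ j := by
  rw [show 2 * k - j = 2 * (k - j) + j by ring, neg_one_zpow_two_mul_add]

lemma neg_one_zpow_neg (k : ℤ) : (-1 : ℂ) ^ (-k) = (-1) ^ k := by
  rw [zpow_neg, ← inv_zpow, inv_neg, inv_one]

lemma tsum_eq_zero_of_odd {α : Type*} (e : α ≃ α) {f : α → ℂ} (h : ∀ x, f (e x) = -f x) :
    ∑' x, f x = 0 := by
  have := e.tsum_eq f
  simp_rw [h, tsum_neg] at this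
  exact self_eq_neg.1 this.symm

/-- The general term of the double theta series
`∑ (-1)^(m+n) (m + 2n + 1) q^(m² + 2n² + 2n)`, which is evaluated in two ways. -/
def doubleThetaTerm (q : ℂ) (p : ℤ × ℤ) : ℂ :=
  (-1) ^ (p.1 + p.2) * ((p.1 + 2 * p.2 + 1 : ℤ) * q ^ (p.1 ^ 2 + 2 * p.2 ^ 2 + 2 * p.2))

lemma hasSum_doubleThetaTerm {q : ℂ} (hq0 : q ≠ 0) (hq : ‖q‖ < 1) :
    HasSum (doubleThetaTerm q) ((∑' m : ℤ, (-1) ^ m * q ^ (m ^ 2)) *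
      ∑' n : ℤ, (-1) ^ n * ((2 * n + 1) * q ^ (2 * n ^ 2 + 2 * n))) := by
  have s₁ (d : ℕ) : Summable fun m : ℤ ↦ ‖(-1 : ℂ) ^ m * (m ^ d * q ^ (m ^ 2))‖ := by
    simpa [norm_neg_one_zpow_mul] using summable_norm_pow_mul_zpow hq0 hq d (a := 1) one_pos 0
  have s₂ (d : ℕ) : Summable fun n : ℤ ↦ ‖(-1 : ℂ) ^ n * (n ^ d * q ^ (2 * n ^ 2 + 2 * n))‖ := by
    simpa only [norm_neg_one_zpow_mul] using
      summable_norm_pow_mul_zpow hq0 hq d (a := 2) two_pos 2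
  have s₃ : Summable fun n : ℤ ↦ ‖(-1 : ℂ) ^ n * ((2 * n + 1) * q ^ (2 * n ^ 2 + 2 * n))‖ :=
    (((s₂ 1).of_norm.mul_left 2).add (s₂ 0).of_norm).congr (fun n ↦ by ring) |>.norm
  have h₁ := (summable_mul_of_summable_norm (s₁ 0) s₃).hasSum
  have h₂ := (summable_mul_of_summable_norm (s₁ 1) (s₂ 0)).hasSum
  rw [← tsum_mul_tsum_of_summable_norm (s₁ 0) s₃] at h₁
  rw [← tsum_mul_tsum_of_summable_norm (s₁ 1) (s₂ 0), tsum_eq_zero_of_odd (Equiv.neg ℤ)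
    (fun m ↦ by rw [Equiv.neg_apply, neg_one_zpow_neg, neg_sq]; push_cast; ring), zero_mul] at h₂
  have hfun : doubleThetaTerm q = fun p ↦
      (-1) ^ p.1 * q ^ (p.1 ^ 2) * ((-1) ^ p.2 * ((2 * p.2 + 1) * q ^ (2 * p.2 ^ 2 + 2 * p.2))) +
      (-1) ^ p.1 * (p.1 * q ^ (p.1 ^ 2)) * ((-1) ^ p.2 * q ^ (2 * p.2 ^ 2 + 2 * p.2)) := by
    funext p
    simp only [doubleThetaTerm]
    rw [zpow_add₀ (neg_ne_zero.2 one_ne_zero), add_assoc (p.1 ^ 2), zpow_add₀ hq0]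
    push_cast
    ring
  rw [hfun]
  simpa only [pow_zero, one_mul, pow_one, add_zero] using h₁.add h₂

lemma tsum_indicator_eq_tsum_comp {α β : Type*} {e : α → β} (he : Function.Injective e)
    {s : Set β} (hs : s = Set.range e) (f : β → ℂ) : ∑' x, s.indicator f x = ∑' x, f (e x) := by
  subst hs
  rw [← he.tsum_eq (fun x hx ↦ Set.mem_of_indicator_ne_zero hx)]
  simp

lemma tsum_mul_tsum_eq_two_mul {q : ℂ} (hq0 : q ≠ 0) (hq : ‖q‖ < 1) :
    (∑' m : ℤ, (-1) ^ m * q ^ (m ^ 2)) *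
      ∑' n : ℤ, (-1) ^ n * ((2 * n + 1) * q ^ (2 * n ^ 2 + 2 * n)) =
    2 * ((∑' k : ℤ, (3 * k + 1) * q ^ (3 * k ^ 2 + 2 * k)) *
      ∑' j : ℤ, (-1) ^ j * q ^ (6 * j ^ 2 + 2 * j)) := by
  have hF := hasSum_doubleThetaTerm hq0 hq
  rw [← hF.tsum_eq]
  set F := doubleThetaTerm q with hFdef
  let s (r : ℤ) : Set (ℤ × ℤ) := {p | (p.1 + 2 * p.2 + 1) % 3 = r}
  have hsplit (p) : F p = (s 0).indicator F p + (s 1).indicator F p + (s 2).indicator F p := by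
    have : (p.1 + 2 * p.2 + 1) % 3 = 0 ∨ (p.1 + 2 * p.2 + 1) % 3 = 1 ∨
      (p.1 + 2 * p.2 + 1) % 3 = 2 := by omega
    rcases this with h | h | h <;> simp only [Set.indicator_apply, s, Set.mem_ofPred_eq, h] <;>
      norm_num
  have hsum (r) : Summable ((s r).indicator F) := hF.summable.indicator _
  have h0 : ∑' p, (s 0).indicator F p = 0 := by
    rw [tsum_indicator_eq_tsum_comp (e := fun x : ℤ × ℤ ↦ (x.1 - 2 * x.2 - 1, x.2 + x.1))]
    · refine tsum_eq_zero_of_odd ((Equiv.neg ℤ).prodCongr (Equiv.refl ℤ)) fun x ↦ ?_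
      simp only [hFdef, doubleThetaTerm, Equiv.prodCongr_apply, Prod.map, Equiv.neg_apply,
        Equiv.refl_apply]
      rw [show -x.1 - 2 * x.2 - 1 + (x.2 + -x.1) = 2 * (-2 * x.1) +
          (x.1 - 2 * x.2 - 1 + (x.2 + x.1)) by ring, neg_one_zpow_two_mul_add,
        show (-x.1 - 2 * x.2 - 1) ^ 2 + 2 * (x.2 + -x.1) ^ 2 + 2 * (x.2 + -x.1) =
          (x.1 - 2 * x.2 - 1) ^ 2 + 2 * (x.2 + x.1) ^ 2 + 2 * (x.2 + x.1) by ring]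
      push_cast
      ring
    · rintro ⟨a, b⟩ ⟨c, d⟩ h
      simp only [Prod.mk.injEq] at h ⊢
      omega
    · ext ⟨m, n⟩
      simp only [s, Set.mem_ofPred_eq, Set.mem_range, Prod.mk.injEq, Prod.exists]
      exact ⟨fun h ↦ ⟨(m + 2 * n + 1) / 3, n - (m + 2 * n + 1) / 3, by omega, by omega⟩,
        by rintro ⟨k, j, h₁, h₂⟩; omega⟩
  have hterm (x : ℤ × ℤ) : F (x.1 - 2 * x.2, x.2 + x.1) =
      (3 * x.1 + 1) * q ^ (3 * x.1 ^ 2 + 2 * x.1) *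
        ((-1) ^ x.2 * q ^ (6 * x.2 ^ 2 + 2 * x.2)) := by
    simp only [hFdef, doubleThetaTerm]
    rw [show x.1 - 2 * x.2 + (x.2 + x.1) = 2 * x.1 - x.2 by ring, neg_one_zpow_two_mul_sub,
      show (x.1 - 2 * x.2) ^ 2 + 2 * (x.2 + x.1) ^ 2 + 2 * (x.2 + x.1) =
        (3 * x.1 ^ 2 + 2 * x.1) + (6 * x.2 ^ 2 + 2 * x.2) by ring, zpow_add₀ hq0]
    push_cast
    ring
  have hprod : ∑' x : ℤ × ℤ, F (x.1 - 2 * x.2, x.2 + x.1) =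
      (∑' k : ℤ, (3 * k + 1) * q ^ (3 * k ^ 2 + 2 * k)) *
        ∑' j : ℤ, (-1) ^ j * q ^ (6 * j ^ 2 + 2 * j) := by
    rw [tsum_mul_tsum_of_summable_norm]
    · exact tsum_congr hterm
    · have t (d : ℕ) := (summable_norm_pow_mul_zpow hq0 hq d (a := 3) three_pos 2).of_norm
      exact (((t 1).mul_left 3).add (t 0)).congr (fun n ↦ by ring) |>.norm
    · simpa only [norm_neg_one_zpow_mul, pow_zero, one_mul] using
        summable_norm_pow_mul_zpow hq0 hq 0 (a := 6) (by norm_num) 2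
  have h1 : ∑' p, (s 1).indicator F p = ∑' x : ℤ × ℤ, F (x.1 - 2 * x.2, x.2 + x.1) := by
    refine tsum_indicator_eq_tsum_comp (e := fun x : ℤ × ℤ ↦ (x.1 - 2 * x.2, x.2 + x.1)) ?_ ?_ F
    · rintro ⟨a, b⟩ ⟨c, d⟩ h
      simp only [Prod.mk.injEq] at h ⊢
      omega
    · ext ⟨m, n⟩
      simp only [s, Set.mem_ofPred_eq, Set.mem_range, Prod.mk.injEq, Prod.exists]
      exact ⟨fun h ↦ ⟨(m + 2 * n + 1) / 3, n - (m + 2 * n + 1) / 3, by omega, by omega⟩,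
        by rintro ⟨k, j, h₁, h₂⟩; omega⟩
  have h2 : ∑' p, (s 2).indicator F p = ∑' x : ℤ × ℤ, F (x.1 - 2 * x.2, x.2 + x.1) := by
    rw [tsum_indicator_eq_tsum_comp (e := fun x : ℤ × ℤ ↦ (2 * x.2 - x.1, -x.2 - x.1 - 1))]
    · refine tsum_congr fun x ↦ ?_
      simp only [hFdef, doubleThetaTerm]
      rw [show 2 * x.2 - x.1 + (-x.2 - x.1 - 1) = 2 * (x.2 - 2 * x.1) +
          (x.1 - 2 * x.2 + (x.2 + x.1) - 1) by ring, neg_one_zpow_two_mul_add,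
        zpow_sub_one₀ (neg_ne_zero.2 one_ne_zero),
        show (2 * x.2 - x.1) ^ 2 + 2 * (-x.2 - x.1 - 1) ^ 2 + 2 * (-x.2 - x.1 - 1) =
          (x.1 - 2 * x.2) ^ 2 + 2 * (x.2 + x.1) ^ 2 + 2 * (x.2 + x.1) by ring]
      push_cast
      rw [inv_neg, inv_one]
      ring
    · rintro ⟨a, b⟩ ⟨c, d⟩ h
      simp only [Prod.mk.injEq] at h ⊢
      omega
    · ext ⟨m, n⟩
      simp only [s, Set.mem_ofPred_eq, Set.mem_range, Prod.mk.injEq, Prod.exists]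
      refine ⟨fun h ↦ ⟨-(m + 2 * n + 2) / 3, -n - 1 - -(m + 2 * n + 2) / 3, by omega, by omega⟩,
        by rintro ⟨k, j, h₁, h₂⟩; omega⟩
  rw [tsum_congr hsplit, ((hsum 0).add (hsum 1)).tsum_add (hsum 2), (hsum 0).tsum_add (hsum 1),
    h0, h1, h2, hprod]
  ring

/-- The theta series `∑ (3k+1) q^(3k²+2k)` as a product. -/
lemma tsum_three_mul_add_one_mul_zpow {q : ℂ} (hq0 : q ≠ 0) (hq : ‖q‖ < 1) :
    ∑' k : ℤ, (3 * k + 1) * q ^ (3 * k ^ 2 + 2 * k) =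
      eulerPhi q ^ 2 * eulerPhi (q ^ 4) ^ 2 / eulerPhi (q ^ 2) := by
  have hpow (n : ℕ) (hn : n ≠ 0) : ‖q ^ n‖ < 1 := by
    rw [norm_pow]; exact pow_lt_one₀ (norm_nonneg _) hq hn
  have hq2 := pow_ne_zero 2 hq0
  have e (n : ℤ) : (q ^ 2) ^ n = q ^ (2 * n) := by rw [zpow_mul]; rfl
  have hcube := tsum_neg_one_zpow_mul_zpow_triangular hq2 (hpow 2 two_ne_zero)
  have hpent := tsum_neg_one_zpow_mul_zpow_pentagonal hq2 (hpow 2 two_ne_zero)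
  simp_rw [e, mul_add, ← mul_assoc, ← pow_mul] at hcube hpent
  norm_num at hcube hpent
  have h := tsum_mul_tsum_eq_two_mul hq0 hq
  have h4 := eulerPhi_ne_zero (hpow 4 four_ne_zero)
  have h2 := eulerPhi_ne_zero (hpow 2 two_ne_zero)
  simp_rw [← mul_assoc ((-1 : ℂ) ^ (_ : ℤ))] at h
  rw [tsum_neg_one_zpow_mul_zpow_sq hq0 hq, hcube, hpent] at h
  rw [eq_div_iff h2]
  field_simp at h
  linear_combination -h

/-- For every `τ` in the upper half-plane, `S_{3,2}(τ) = 2η(τ)²η(4τ)²/η(2τ)`,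
i.e. `∑_{k∈ℤ} (6k+2) q^{(6k+2)²/12} = 2 q^{1/3} ∏_{n≥1} (1 − qⁿ)² (1 − q^{4n})² (1 − q^{2n})⁻¹`. -/
theorem stmt_7 (τ : ℂ) (hτ : 0 < τ.im) :
    Sth 3 2 τ = 2 * dedekindEta τ ^ 2 * dedekindEta (4 * τ) ^ 2 / dedekindEta (2 * τ) := by
  have hq0 : qq τ ≠ 0 := exp_ne_zero _
  have hq : ‖qq τ‖ < 1 := by
    simpa [qq] using UpperHalfPlane.norm_exp_two_pi_I_lt_one ⟨τ, hτ⟩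
  have hmul (n : ℕ) : qq (n * τ) = qq τ ^ n := by
    rw [qq, qq, ← exp_nat_mul]; congr 1; ring
  have hη (n : ℕ) : dedekindEta (n * τ) =
      exp (2 * Real.pi * I * τ / 24) ^ n * eulerPhi (qq τ ^ n) := by
    rw [dedekindEta, eulerPhi, hmul, ← exp_nat_mul]; congr 2; ring
  have h1 := hη 1
  have h2 := hη 2
  have h4 := hη 4
  norm_num at h1 h2 h4
  have hS : Sth 3 2 τ = 2 * exp (2 * Real.pi * I * τ / 24) ^ 8 *
      ∑' k : ℤ, (3 * k + 1) * qq τ ^ (3 * k ^ 2 + 2 * k) := by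
    rw [Sth, ← tsum_mul_left]
    refine tsum_congr fun k ↦ ?_
    have : exp (2 * Real.pi * I * τ *
        (((2 * ((3 : ℕ) : ℤ) * k + 2 : ℤ) : ℂ) ^ 2 / (4 * ((3 : ℕ) : ℂ)))) =
        exp (2 * Real.pi * I * τ / 24) ^ 8 * qq τ ^ (3 * k ^ 2 + 2 * k) := by
      rw [qq, ← exp_nat_mul, ← exp_int_mul, ← exp_add]
      congr 1
      push_cast
      ring
    rw [this]
    push_cast
    ring
  have he := exp_ne_zero (2 * Real.pi * I * τ / 24)
  have hφ := eulerPhi_ne_zero (q := qq τ ^ 2)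
    (by rw [norm_pow]; exact pow_lt_one₀ (norm_nonneg _) hq two_ne_zero)
  rw [hS, tsum_three_mul_add_one_mul_zpow hq0 hq, h1, h2, h4]
  field_simp
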